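/- Suppose given two gluing data ({g^δ_{ij}}, {θ^δ_{ij}}), δ = 1, 2, together with φ_i-semilinear actions Φ^δ_i of G_i on the same modules E_i, each satisfying conditions (A)–(D), and assume Φ^1_1 = Φ^2_1 =: Ψ. For 2 ≤ j ≤ l set f_j = (g^1_{1j})^{-1} g^2_{1j}, which lies in G_1 (both g^1_{1j} and g^2_{1j} send the index 1 to j), set f_1 = 1, and define τ_j = θ^2_{1j} ∘ Ψ(f_j^{-1}) ∘ (θ^1_{1j})^{-1} : E_j → E_j. Then each τ_j is an R_j-linear automorphism of E_j and Φ^2_j(b) = τ_j ∘ Φ^1_j(b) ∘ τ_j^{-1} for every b ∈ G_j. -/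

import Mathlib

/-- If `φ` acts on a product of rings by moving the factors along `α`, then the transported value
of `α g i` at the `i`-th component of `r` is the component of `φ g r` at the image index. -/
theorem cast_factor_equiv_eq {G ι : Type*} [Group G] {R : ι → Type*} [∀ i, CommRing (R i)]
    {a : G → ι → ι} {α : ∀ (g : G) (i : ι), R i ≃+* R (a g i)} {φ : G →* RingAut (∀ i, R i)}
    (hφ : ∀ (g : G) (r : ∀ i, R i) (i : ι), φ g r (a g i) = α g i (r i))
    {g : G} {i j : ι} (hg : a g i = j) (r : ∀ i, R i) :
    cast (congrArg R hg) (α g i (r i)) = φ g r j := by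
  subst hg
  exact (hφ g r i).symm

/-- The componentwise intertwiners `τ_j`.  Given two gluing
data `({gg δ i j}, {θ δ i j})` (`δ = 1, 2`) with `φᵢ`-semilinear stabilizer
actions `Φ δ i` on the same modules `E i`, each satisfying conditions (A)–(D),
and with `Ψ := Φ 1 i₀ = Φ 2 i₀` at the index `i₀ = 1`, set
`f j = (gg 1 i₀ j)⁻¹ * gg 2 i₀ j ∈ G_{i₀}` and
`τ j = θ 2 i₀ j ∘ Ψ (f j)⁻¹ ∘ (θ 1 i₀ j)⁻¹ : E j → E j`.
Then each `τ j` is an `R j`-linear automorphism of `E j` and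
`Φ 2 j b = τ j ∘ Φ 1 j b ∘ (τ j)⁻¹` for every `b ∈ G_j`. -/
theorem component_intertwiner_conjugates
    {G : Type} [Group G] {l : ℕ} (hl : 0 < l)
    (R : Fin l → Type) [∀ i, CommRing (R i)]
    (E : Fin l → Type) [∀ i, AddCommGroup (E i)] [∀ i, Module (R i) (E i)]
    (a : G → Fin l → Fin l)
    (ha_one : ∀ i, a 1 i = i)
    (ha_mul : ∀ g h i, a (g * h) i = a g (a h i))
    (α : ∀ (g : G) (i : Fin l), R i ≃+* R (a g i))
    (φ : G →* RingAut (∀ i, R i))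
    (hφ : ∀ (g : G) (r : ∀ i, R i) (i : Fin l), φ g r (a g i) = α g i (r i))
    -- the two families of semilinear stabilizer actions
    (Φ : Fin 2 → ∀ i : Fin l, G → (E i ≃+ E i))
    (hΦ_one : ∀ δ i, Φ δ i 1 = AddEquiv.refl (E i))
    (hΦ_mul : ∀ δ (i : Fin l) (g h : G), a g i = i → a h i = i →
      ∀ x, Φ δ i (g * h) x = Φ δ i g (Φ δ i h x))
    (hΦ_semi : ∀ δ (i : Fin l) (g : G) (hg : a g i = i) (r : R i) (x : E i),
      Φ δ i g (r • x) = cast (congrArg R hg) (α g i r) • Φ δ i g x)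
    -- the two gluing data
    (gg : Fin 2 → Fin l → Fin l → G)
    (hgg : ∀ δ i j, a (gg δ i j) i = j)
    (θ : Fin 2 → ∀ i j : Fin l, E i ≃+ E j)
    -- conditions (A)–(D) for each datum
    (hA : ∀ δ i j k, gg δ i k = gg δ j k * gg δ i j)
    (hA1 : ∀ δ i, gg δ i i = 1)
    (hB : ∀ δ i j k x, θ δ i k x = θ δ j k (θ δ i j x))
    (hB1 : ∀ δ i, θ δ i i = AddEquiv.refl (E i))
    (hC : ∀ δ (i j : Fin l) (b : G), a b i = i →
      ∀ x, Φ δ j (gg δ i j * b * (gg δ i j)⁻¹) (θ δ i j x) = θ δ i j (Φ δ i b x))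
    (hD : ∀ δ (i j : Fin l) (r : R i) (x : E i),
      θ δ i j (r • x) = cast (congrArg R (hgg δ i j)) (α (gg δ i j) i r) • θ δ i j x)
    -- the assumption `Ψ := Φ¹_1 = Φ²_1` on the stabilizer of the index `1`
    (hΦeq : ∀ g : G, a g ⟨0, hl⟩ = ⟨0, hl⟩ → Φ 0 ⟨0, hl⟩ g = Φ 1 ⟨0, hl⟩ g) :
    -- with `τ j := θ² i₀ j ∘ Ψ((f j)⁻¹) ∘ (θ¹ i₀ j)⁻¹` where
    -- `f j := (gg¹ i₀ j)⁻¹ * gg² i₀ j`, `i₀ := 1`: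
    ∀ j : Fin l,
      -- `τ j` is bijective …
      (Function.Bijective (fun x : E j =>
        θ 1 ⟨0, hl⟩ j (Φ 0 ⟨0, hl⟩ ((gg 0 ⟨0, hl⟩ j)⁻¹ * gg 1 ⟨0, hl⟩ j)⁻¹
          ((θ 0 ⟨0, hl⟩ j).symm x)))) ∧
      -- … and `R j`-linear …
      (∀ (r : R j) (x : E j),
        θ 1 ⟨0, hl⟩ j (Φ 0 ⟨0, hl⟩ ((gg 0 ⟨0, hl⟩ j)⁻¹ * gg 1 ⟨0, hl⟩ j)⁻¹
            ((θ 0 ⟨0, hl⟩ j).symm (r • x)))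
          = r • θ 1 ⟨0, hl⟩ j (Φ 0 ⟨0, hl⟩ ((gg 0 ⟨0, hl⟩ j)⁻¹ * gg 1 ⟨0, hl⟩ j)⁻¹
              ((θ 0 ⟨0, hl⟩ j).symm x))) ∧
      -- … and conjugates `Φ¹_j` into `Φ²_j`: `Φ²_j(b) ∘ τ j = τ j ∘ Φ¹_j(b)`
      (∀ b : G, a b j = j → ∀ x : E j,
        Φ 1 j b (θ 1 ⟨0, hl⟩ j (Φ 0 ⟨0, hl⟩ ((gg 0 ⟨0, hl⟩ j)⁻¹ * gg 1 ⟨0, hl⟩ j)⁻¹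
            ((θ 0 ⟨0, hl⟩ j).symm x)))
          = θ 1 ⟨0, hl⟩ j (Φ 0 ⟨0, hl⟩ ((gg 0 ⟨0, hl⟩ j)⁻¹ * gg 1 ⟨0, hl⟩ j)⁻¹
              ((θ 0 ⟨0, hl⟩ j).symm (Φ 0 j b x)))) := by
  intro j
  generalize (⟨0, hl⟩ : Fin l) = i at *
  have a_inv : ∀ {g : G} {k m : Fin l}, a g k = m → a g⁻¹ m = k := by
    intro g k m h
    rw [← h, ← ha_mul, inv_mul_cancel, ha_one]
  have hf : a ((gg 0 i j)⁻¹ * gg 1 i j)⁻¹ i = i := by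
    rw [mul_inv_rev, inv_inv, ha_mul, hgg, a_inv (hgg 1 i j)]
  have conj_mem : ∀ δ {b : G}, a b j = j → a ((gg δ i j)⁻¹ * b * gg δ i j) i = i := by
    intro δ b hb
    rw [ha_mul, ha_mul, hgg, hb, a_inv (hgg δ i j)]
  have hθ : ∀ δ {b : G}, a b j = j → ∀ y,
      Φ δ j b (θ δ i j y) = θ δ i j (Φ δ i ((gg δ i j)⁻¹ * b * gg δ i j) y) := by
    intro δ b hb y
    rw [← hC δ i j _ (conj_mem δ hb)]
    congr 2
    group
  refine ⟨?_, ?_, ?_⟩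
  · exact (θ 1 i j).bijective.comp ((Φ 0 i _).bijective.comp (θ 0 i j).symm.bijective)
  · intro r x
    obtain ⟨y, rfl⟩ := (θ 0 i j).surjective x
    obtain ⟨ρ, hρ⟩ := (φ (gg 0 i j)).surjective (Pi.single j r)
    have hr : φ (gg 0 i j) ρ j = r := by rw [hρ, Pi.single_eq_same]
    have h0 : r • θ 0 i j y = θ 0 i j (ρ i • y) := by
      rw [hD, cast_factor_equiv_eq hφ (hgg 0 i j), hr]
    rw [h0, AddEquiv.symm_apply_apply, AddEquiv.symm_apply_apply, hΦ_semi 0 i _ hf,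
      cast_factor_equiv_eq hφ hf, hD, cast_factor_equiv_eq hφ (hgg 1 i j), ← RingAut.mul_apply,
      ← map_mul, mul_inv_rev, inv_inv, mul_inv_cancel_left, hr]
  · intro b hb x
    obtain ⟨y, rfl⟩ := (θ 0 i j).surjective x
    rw [hθ 0 hb, AddEquiv.symm_apply_apply, AddEquiv.symm_apply_apply, hθ 1 hb,
      ← hΦeq _ (conj_mem 1 hb), ← hΦ_mul 0 i _ _ (conj_mem 1 hb) hf,
      ← hΦ_mul 0 i _ _ hf (conj_mem 0 hb)]
    congr 3
    group
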